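/- arXiv:1901.03102 — 3 statements merged into one kernel-verified Lean document; each statement's English description precedes it below -/
import Mathlib

section
/- Let ξ, η, μ, ν, k ∈ ℂ and q a non-negative integer. Assume that for every integer m ≥ 0 the quantities ξ+μ+2m, ξ+μ+2m+1, ξ+μ+2m+3, ξ+μ+2m+4 are nonzero (so K_m, L_m, M_m are well-defined) and that M_m ≠ 0 for every m ≥ 0. Suppose one of the following three conditions holds: ξ+η+μ+ν = −2q−4, or ξ+η+μ−ν = −2q−3, or μ = −(2q+3)/2. Then K_{q+1} = 0, the function h ↦ X_{q+1}(h) is a polynomial function of h of degree exactly q+1, and there exists h ∈ ℂ such that X_m(h) = 0 for all m ≥ q+1 (i.e., the series expansion terminates). If in addition K_m ≠ 0 for all 1 ≤ m ≤ q, then for every such h one also has X_q(h) ≠ 0. -/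
/-- The coefficient `K_m` of the three-term recursion for the hypergeometric
series expansion of the local Darboux solution. -/
noncomputable def darbouxK (ξ η μ ν : ℂ) (m : ℕ) : ℂ :=
  (ξ + η + μ + ν + 2 * m + 2) * (ξ + η + μ - ν + 2 * m + 1) * (ξ + μ + m + 1)
      * (2 * μ + 2 * m + 1)
    / (2 * (ξ + μ + 2 * m + 1) * (ξ + μ + 2 * m))

/-- The coefficient `L_m` of the three-term recursion for the hypergeometric
series expansion of the local Darboux solution. -/
noncomputable def darbouxL (ξ η μ ν h k : ℂ) (m : ℕ) : ℂ :=
  ((ξ + η + μ + ν + 2 * m + 4) * (ξ - η + μ + ν + 2 * m + 3)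
        / (2 * (ξ + μ + 2 * m + 3) * (ξ + μ + 2 * m + 1))
      + (ξ + η + μ - ν + 2 * m + 3) * (ξ - η + μ - ν + 2 * m + 2)
        / (2 * (ξ + μ + 2 * m + 3) * (ξ + μ + 2 * m + 1))
      - 2 / (ξ + μ + 2 * m + 1)) * (2 * ξ + 2 * m + 1) * m
    - (2 * μ + 3) * (ξ + η + μ + ν + 2 * m + 4) * (ξ + η + μ - ν + 2 * m + 3)
        / (2 * (ξ + μ + 2 * m + 3))
    + 2 * (2 * μ + 3) * m + h - ξ * (ξ + 1) * k ^ 2 + (ξ + 1) * (1 - k ^ 2)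
    + 2 * (μ + 1) * (ξ + 1) * (1 - k ^ 2) - 4 * k ^ 2 * m * (ξ + μ + m + 2)
    - ν * (ν + 1) + (μ + 1) ^ 2 * (1 - k ^ 2) + 2 * (μ + 1) * (η + 1) + μ + η + 2

/-- The coefficient `M_m` of the three-term recursion for the hypergeometric
series expansion of the local Darboux solution. -/
noncomputable def darbouxM (ξ η μ ν : ℂ) (m : ℕ) : ℂ :=
  (m + 1) * (2 * ξ + 2 * m + 3) * (ξ - η + μ + ν + 2 * m + 3)
      * (ξ - η + μ - ν + 2 * m + 2)
    / (2 * (ξ + μ + 2 * m + 4) * (ξ + μ + 2 * m + 3))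

theorem darbouxL_eq_add (ξ η μ ν h k : ℂ) (m : ℕ) :
    darbouxL ξ η μ ν h k m = h + darbouxL ξ η μ ν 0 k m := by
  unfold darbouxL
  ring

theorem darbouxK_succ_eq_zero {ξ η μ ν : ℂ} {q : ℕ}
    (hcond : ξ + η + μ + ν = -2 * q - 4 ∨ ξ + η + μ - ν = -2 * q - 3 ∨
      μ = -(2 * q + 3) / 2) :
    darbouxK ξ η μ ν (q + 1) = 0 := by
  unfold darbouxK
  push_cast
  rcases hcond with h | h | h
  · have : ξ + η + μ + ν + 2 * (q + 1 : ℂ) + 2 = 0 := by rw [h]; ring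
    simp [this]
  · have : ξ + η + μ - ν + 2 * (q + 1 : ℂ) + 1 = 0 := by rw [h]; ring
    simp [this]
  · have : 2 * μ + 2 * (q + 1 : ℂ) + 1 = 0 := by rw [h]; ring
    simp [this]

/-- The solution of a three-term recursion whose middle coefficient is `h + L m` is, at index `m`,
a polynomial of degree `m` in `h`. -/
theorem exists_polynomial_of_three_term_recursion {F : Type*} [Field F] {K L M : ℕ → F}
    {x : F → ℕ → F} (hM : ∀ m, M m ≠ 0) (h0 : ∀ h, x h 0 = 1)
    (h1 : ∀ h, (h + L 0) * x h 0 + M 0 * x h 1 = 0)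
    (hrec : ∀ h m, K (m + 1) * x h m + (h + L (m + 1)) * x h (m + 1)
      + M (m + 1) * x h (m + 2) = 0) (m : ℕ) :
    ∃ p : Polynomial F, p.degree = m ∧ ∀ h, x h m = p.eval h := by
  open Polynomial in
  induction m using Nat.twoStepInduction with
  | zero => exact ⟨1, by simp, by simp [h0]⟩
  | one =>
    refine ⟨C (-(M 0)⁻¹) * (X + C (L 0)), ?_, fun h => ?_⟩
    · rw [degree_C_mul (neg_ne_zero.2 (inv_ne_zero (hM 0))), degree_X_add_C, Nat.cast_one]
    · have := h1 h
      have hM0 := hM 0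
      rw [h0] at this
      simp only [eval_mul, eval_C, eval_add, eval_X]
      field_simp
      linear_combination this
  | more m ihm ihm1 =>
    obtain ⟨p, hp, hpx⟩ := ihm
    obtain ⟨r, hr, hrx⟩ := ihm1
    refine ⟨C (-(M (m + 1))⁻¹) * (K (m + 1) • p + (X + C (L (m + 1))) * r), ?_, fun h => ?_⟩
    · have hlead : ((X + C (L (m + 1))) * r).degree = ((m + 2 : ℕ) : WithBot ℕ) := by
        rw [degree_mul, degree_X_add_C, hr]
        norm_cast
        omega
      rw [degree_C_mul (neg_ne_zero.2 (inv_ne_zero (hM _))), degree_add_eq_right_of_degree_lt,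
        hlead]
      rw [hlead]
      refine (degree_smul_le (K (m + 1)) p).trans_lt ?_
      rw [hp]
      exact_mod_cast (by omega : m < m + 2)
    · have := hrec h m
      have hMm := hM (m + 1)
      simp only [eval_mul, eval_C, eval_add, eval_X, eval_smul, smul_eq_mul, ← hpx, ← hrx]
      field_simp
      linear_combination this

/-- A solution of a three-term recursion vanishes from an index on where `K` and the solution
vanish. -/
theorem eq_zero_of_three_term_recursion {R : Type*} [Ring R] [NoZeroDivisors R]
    {K L M x : ℕ → R} {q : ℕ} (hM : ∀ m, M m ≠ 0)
    (hrec : ∀ m, K (m + 1) * x m + L (m + 1) * x (m + 1) + M (m + 1) * x (m + 2) = 0)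
    (hK : K (q + 1) = 0) (hx : x (q + 1) = 0) {m : ℕ} (hm : q + 1 ≤ m) : x m = 0 := by
  suffices ∀ n, x (q + 1 + n) = 0 by
    obtain ⟨n, rfl⟩ := Nat.exists_eq_add_of_le hm
    exact this n
  intro n
  induction n using Nat.twoStepInduction with
  | zero => exact hx
  | one => simpa [hK, hx, hM] using hrec q
  | more n ihn ihn1 =>
    have := hrec (q + 1 + n)
    rw [ihn, show q + 1 + n + 1 = q + 1 + (n + 1) from rfl, ihn1] at this
    simpa [hM, add_assoc] using this

/-- Two consecutive zeros of a solution of a three-term recursion propagate back to the initial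
value as long as `K` does not vanish. -/
theorem eq_zero_of_three_term_recursion_backward {R : Type*} [Ring R] [NoZeroDivisors R]
    {K L M x : ℕ → R}
    (hrec : ∀ m, K (m + 1) * x m + L (m + 1) * x (m + 1) + M (m + 1) * x (m + 2) = 0)
    {q : ℕ} (hK : ∀ m, 1 ≤ m → m ≤ q → K m ≠ 0) (hx : x q = 0) (hx1 : x (q + 1) = 0) :
    x 0 = 0 := by
  induction q with
  | zero => exact hx
  | succ q ih =>
    refine ih (fun m hm hmq => hK m hm (by omega)) ?_ hx
    simpa [hx, hx1, hK (q + 1) (by omega) le_rfl] using hrec q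

/-- Termination of the hypergeometric-series expansion of the local Darboux
solution: under one of the three parameter conditions, `K_{q+1} = 0`,
`h ↦ X_{q+1}(h)` is a polynomial of degree exactly `q+1`, and there is an
accessory parameter `h` at which the expansion terminates; if moreover
`K_m ≠ 0` for `1 ≤ m ≤ q`, the last coefficient `X_q(h)` is nonzero. -/
theorem darboux_hypergeometric_expansion_terminates (ξ η μ ν k : ℂ) (q : ℕ)
    (hden : ∀ m : ℕ, ξ + μ + 2 * m ≠ 0 ∧ ξ + μ + 2 * m + 1 ≠ 0 ∧
      ξ + μ + 2 * m + 3 ≠ 0 ∧ ξ + μ + 2 * m + 4 ≠ 0)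
    (hM : ∀ m : ℕ, darbouxM ξ η μ ν m ≠ 0)
    (X : ℂ → ℕ → ℂ)
    (hX0 : ∀ h : ℂ, X h 0 = 1)
    (hX1 : ∀ h : ℂ, darbouxL ξ η μ ν h k 0 * X h 0 + darbouxM ξ η μ ν 0 * X h 1 = 0)
    (hXrec : ∀ h : ℂ, ∀ m : ℕ,
      darbouxK ξ η μ ν (m + 1) * X h m + darbouxL ξ η μ ν h k (m + 1) * X h (m + 1)
        + darbouxM ξ η μ ν (m + 1) * X h (m + 2) = 0)
    (hcond : ξ + η + μ + ν = -2 * q - 4 ∨ ξ + η + μ - ν = -2 * q - 3 ∨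
      μ = -(2 * q + 3) / 2) :
    darbouxK ξ η μ ν (q + 1) = 0 ∧
    (∃ p : Polynomial ℂ, p.degree = (q + 1 : ℕ) ∧ ∀ h : ℂ, X h (q + 1) = p.eval h) ∧
    (∃ h : ℂ, ∀ m : ℕ, q + 1 ≤ m → X h m = 0) ∧
    ((∀ m : ℕ, 1 ≤ m → m ≤ q → darbouxK ξ η μ ν m ≠ 0) →
      ∀ h : ℂ, (∀ m : ℕ, q + 1 ≤ m → X h m = 0) → X h q ≠ 0) := by
  have hK := darbouxK_succ_eq_zero hcond
  obtain ⟨p, hp, hpx⟩ := exists_polynomial_of_three_term_recursion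
    (L := darbouxL ξ η μ ν 0 k) hM hX0
    (fun h => by simpa only [darbouxL_eq_add ξ η μ ν h] using hX1 h)
    (fun h m => by simpa only [darbouxL_eq_add ξ η μ ν h] using hXrec h m) (q + 1)
  refine ⟨hK, ⟨p, hp, hpx⟩, ?_, fun hKm h hh hq => ?_⟩
  · obtain ⟨h, hh⟩ := IsAlgClosed.exists_root p (by rw [hp]; exact_mod_cast q.succ_ne_zero)
    exact ⟨h, fun m hm =>
      eq_zero_of_three_term_recursion hM (hXrec h) hK ((hpx h).trans hh) hm⟩
  · exact one_ne_zero <| (hX0 h).symm.trans <|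
      eq_zero_of_three_term_recursion_backward (hXrec h) hKm hq (hh (q + 1) le_rfl)
end

section
/- Let (K_m)_{m≥1}, (L_m)_{m≥0}, (M_m)_{m≥0} be sequences of complex numbers with M_m ≠ 0 for every m ≥ 0, and let (X_m)_{m≥0} satisfy X_0 = 1, L_0 X_0 + M_0 X_1 = 0 and K_m X_{m−1} + L_m X_m + M_m X_{m+1} = 0 for m ≥ 1. Fix an integer q ≥ 0 and define, by downward recursion, g_q = L_q/M_q and g_m = L_m/M_m − (K_{m+1}/M_{m+1})/g_{m+1} for 0 ≤ m < q. Assume g_m ≠ 0 for all 1 ≤ m ≤ q. Then X_{q+1} = 0 if and only if the finite continued fraction g_0 = L_0/M_0 − (K_1/M_1)/(L_1/M_1 − (K_2/M_2)/(⋯ − (K_q/M_q)/(L_q/M_q))) equals 0. -/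
/-- The defect `X_{m+1} + (L_m/M_m - g_m) X_m` of a solution of the three-term recursion with
respect to the continued-fraction tails is multiplied by `-g_{m+1}` when `m` increases by one. -/
theorem threeTermRecursion_defect_succ {F : Type*} [Field F] {k l₀ m₀ l₁ m₁ x₀ x₁ x₂ g₀ g₁ : F}
    (hm₁ : m₁ ≠ 0) (hg₁ : g₁ ≠ 0) (hrec : k * x₀ + l₁ * x₁ + m₁ * x₂ = 0)
    (hg : g₀ = l₀ / m₀ - k / m₁ / g₁) :
    x₂ + (l₁ / m₁ - g₁) * x₁ = -g₁ * (x₁ + (l₀ / m₀ - g₀) * x₀) := by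
  rw [hg, sub_sub_cancel]
  field_simp
  linear_combination hrec

/-- Equivalence between the vanishing of `X_{q+1}` and the vanishing of the
finite continued fraction
`g₀ = L₀/M₀ − (K₁/M₁)/(L₁/M₁ − (K₂/M₂)/(⋯ − (K_q/M_q)/(L_q/M_q)))`,
evaluated by the downward recursion `g_q = L_q/M_q`,
`g_m = L_m/M_m − (K_{m+1}/M_{m+1})/g_{m+1}`. -/
theorem threeTermRecursion_termination_iff_continuedFraction_vanishes
    (K L M : ℕ → ℂ) (hM : ∀ m : ℕ, M m ≠ 0)
    (X : ℕ → ℂ)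
    (hX0 : X 0 = 1)
    (hX1 : L 0 * X 0 + M 0 * X 1 = 0)
    (hrec : ∀ m : ℕ, K (m + 1) * X m + L (m + 1) * X (m + 1) + M (m + 1) * X (m + 2) = 0)
    (q : ℕ) (g : ℕ → ℂ)
    (hgq : g q = L q / M q)
    (hg : ∀ m : ℕ, m < q → g m = L m / M m - (K (m + 1) / M (m + 1)) / g (m + 1))
    (hgne : ∀ m : ℕ, 1 ≤ m → m ≤ q → g m ≠ 0) :
    X (q + 1) = 0 ↔ g 0 = 0 := by
  have key : ∀ m ≤ q, X (m + 1) + (L m / M m - g m) * X m = 0 ↔ g 0 = 0 := by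
    intro m
    induction m with
    | zero =>
      intro _
      have h : X 1 + (L 0 / M 0 - g 0) * X 0 = -g 0 := by
        have hM0 := hM 0
        rw [hX0] at hX1 ⊢
        field_simp
        linear_combination hX1
      rw [h, neg_eq_zero]
    | succ m ih =>
      intro hm
      have hne := hgne (m + 1) (by omega) hm
      rw [threeTermRecursion_defect_succ (hM (m + 1)) hne (hrec m) (hg m hm), mul_eq_zero,
        neg_eq_zero, or_iff_right hne]
      exact ih (by omega)
  simpa [hgq] using key q le_rfl
end

section
/- Let ξ, η, μ, ν, k ∈ ℂ, and assume 2m + 2ξ + 3 ≠ 0 for every integer m ≥ 0 (i.e., ξ ∉ {−3/2, −5/2, −7/2, …}). Let q be a non-negative integer and suppose that ξ+η+μ+ν = −2q−4 or ξ+η+μ−ν = −2q−3. Then the function h ↦ C_{q+1}(h) is a polynomial function of h of degree exactly q+1, and there exists h ∈ ℂ such that C_m(h) = 0 for all m ≥ q+1; that is, the power-series expansion of the local Darboux solution terminates and the solution is sn(u,k)^{ξ+1} cn(u,k)^{η+1} dn(u,k)^{μ+1} times a polynomial of degree at most q in sn(u,k)². -/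
open Polynomial in
/-- One step of a three-term recursion whose middle coefficient is affine in the parameter
raises the degree of a polynomial solution by one. -/
lemma exists_degree_eq_succ_of_recursion {K : Type*} [Field K] {n : ℕ} {p r : K[X]}
    (hp : p.degree = n) (hr : r.degree < (n + 1 : ℕ)) {a : K} (ha : a ≠ 0) (b c : K)
    {f : K → K} (hf : ∀ h, a * f h + (h + b) * p.eval h + c * r.eval h = 0) :
    ∃ s : K[X], s.degree = (n + 1 : ℕ) ∧ ∀ h, f h = s.eval h := by
  refine ⟨C (-a⁻¹) * ((X + C b) * p + C c * r), ?_, fun h => ?_⟩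
  · have h1 : ((X + C b) * p).degree = ((n + 1 : ℕ) : WithBot ℕ) := by
      rw [degree_mul, degree_X_add_C, hp, add_comm]
      rfl
    have h2 : (C c * r).degree < ((X + C b) * p).degree := by
      rw [h1]
      refine lt_of_le_of_lt ?_ hr
      rw [← smul_eq_C_mul]
      exact degree_smul_le c r
    rw [degree_C_mul (neg_ne_zero.mpr (inv_ne_zero ha)), degree_add_eq_left_of_degree_lt h2, h1]
  · have := hf h
    simp only [eval_mul, eval_add, eval_C, eval_X]
    field_simp
    linear_combination this


/-- Termination of the power-series expansion of the local Darboux solution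
(the Darboux polynomial case): if `ξ+η+μ+ν = −2q−4` or `ξ+η+μ−ν = −2q−3`, then
`h ↦ C_{q+1}(h)` is a polynomial of degree exactly `q+1` and there is an
accessory parameter `h` at which all coefficients `C_m(h)`, `m ≥ q+1`, vanish,
i.e. the solution is `sn^{ξ+1}cn^{η+1}dn^{μ+1}` times a polynomial of degree at
most `q` in `sn²`. -/
theorem darboux_power_series_terminates (ξ η μ ν k : ℂ)
    (hξ : ∀ m : ℕ, 2 * (m : ℂ) + 2 * ξ + 3 ≠ 0)
    (q : ℕ)
    (hcond : ξ + η + μ + ν = -2 * (q : ℂ) - 4 ∨ ξ + η + μ - ν = -2 * (q : ℂ) - 3)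
    (C : ℂ → ℕ → ℂ)
    (hC0 : ∀ h : ℂ, C h 0 = 1)
    (hC1 : ∀ h : ℂ, 2 * (2 * ξ + 3) * C h 1
      + (h - (η + ξ + 2) ^ 2 - k ^ 2 * (μ + ξ + 2) ^ 2 + (k ^ 2 + 1) * (ξ + 1) ^ 2)
          * C h 0 = 0)
    (hCrec : ∀ h : ℂ, ∀ m : ℕ,
      (2 * ((m : ℂ) + 1) + 2) * (2 * ((m : ℂ) + 1) + 2 * ξ + 3) * C h (m + 2)
        + (h - (2 * ((m : ℂ) + 1) + η + ξ + 2) ^ 2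
            - k ^ 2 * (2 * ((m : ℂ) + 1) + μ + ξ + 2) ^ 2
            + (k ^ 2 + 1) * (ξ + 1) ^ 2) * C h (m + 1)
        + k ^ 2 * (2 * ((m : ℂ) + 1) + ξ + η + μ + ν + 2)
            * (2 * ((m : ℂ) + 1) + ξ + η + μ - ν + 1) * C h m = 0) :
    (∃ p : Polynomial ℂ, p.degree = (q + 1 : ℕ) ∧ ∀ h : ℂ, C h (q + 1) = p.eval h) ∧
    ∃ h : ℂ, ∀ m : ℕ, q + 1 ≤ m → C h m = 0 := by
  have ha : ∀ m : ℕ, (2 * ((m : ℂ) + 1) + 2) * (2 * ((m : ℂ) + 1) + 2 * ξ + 3) ≠ 0 := fun m => by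
    refine mul_ne_zero ?_ ?_
    · exact_mod_cast (by omega : 2 * (m + 1) + 2 ≠ 0)
    · simpa using hξ (m + 1)
  have key : ∀ m : ℕ, (∃ p : Polynomial ℂ, p.degree = m ∧ ∀ h, C h m = p.eval h) ∧
      ∃ p : Polynomial ℂ, p.degree = (m + 1 : ℕ) ∧ ∀ h, C h (m + 1) = p.eval h := by
    intro m
    induction m with
    | zero =>
      refine ⟨⟨1, by simp, fun h => by simp [hC0]⟩, ?_⟩
      refine exists_degree_eq_succ_of_recursion (p := 1) (r := 0) (by simp)
        (by rw [Polynomial.degree_zero]; exact WithBot.bot_lt_coe _)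
        (mul_ne_zero two_ne_zero (by simpa using hξ 0))
        (-(η + ξ + 2) ^ 2 - k ^ 2 * (μ + ξ + 2) ^ 2 + (k ^ 2 + 1) * (ξ + 1) ^ 2) 0 fun h => ?_
      have := hC1 h
      rw [hC0] at this
      simp only [Polynomial.eval_one, Polynomial.eval_zero]
      linear_combination this
    | succ m ih =>
      obtain ⟨⟨r, hr, hrC⟩, p, hp, hpC⟩ := ih
      refine ⟨⟨p, hp, hpC⟩, exists_degree_eq_succ_of_recursion (r := r) hp
        (by rw [hr]; exact_mod_cast (by omega : m < m + 1 + 1)) (ha m)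
        (-(2 * ((m : ℂ) + 1) + η + ξ + 2) ^ 2 - k ^ 2 * (2 * ((m : ℂ) + 1) + μ + ξ + 2) ^ 2
          + (k ^ 2 + 1) * (ξ + 1) ^ 2)
        (k ^ 2 * (2 * ((m : ℂ) + 1) + ξ + η + μ + ν + 2)
          * (2 * ((m : ℂ) + 1) + ξ + η + μ - ν + 1)) fun h => ?_⟩
      rw [← hrC, ← hpC]
      linear_combination hCrec h m
  obtain ⟨p, hp, hpC⟩ := (key q).2
  refine ⟨⟨p, hp, hpC⟩, ?_⟩
  obtain ⟨h, hh⟩ := Complex.exists_root (f := p) (by rw [hp]; exact_mod_cast q.succ_pos)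
  have hq : C h (q + 1) = 0 := (hpC h).trans hh
  have hvanish : (2 * ((q : ℂ) + 1) + ξ + η + μ + ν + 2)
      * (2 * ((q : ℂ) + 1) + ξ + η + μ - ν + 1) = 0 := by
    rcases hcond with hc | hc
    · exact mul_eq_zero_of_left (by linear_combination hc) _
    · exact mul_eq_zero_of_right _ (by linear_combination hc)
  have hzero : ∀ n : ℕ, C h (q + 1 + n) = 0 ∧ C h (q + 1 + n + 1) = 0 := by
    intro n
    induction n with
    | zero =>
      refine ⟨hq, (mul_eq_zero.mp ?_).resolve_left (ha q)⟩
      have := hCrec h q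
      rw [hq] at this
      linear_combination this - k ^ 2 * C h q * hvanish
    | succ n ih =>
      refine ⟨ih.2, (mul_eq_zero.mp ?_).resolve_left (ha (q + 1 + n))⟩
      have := hCrec h (q + 1 + n)
      rw [ih.1, ih.2] at this
      linear_combination this
  refine ⟨h, fun m hm => ?_⟩
  obtain ⟨n, rfl⟩ := Nat.exists_eq_add_of_le hm
  exact (hzero n).1
end
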